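/- Let G be a profinite group and U a pseudocompact k⟦G⟧-module, so that U is the inverse limit of its coinvariant modules U_N over open normal subgroups N of G. Then: (1) for each i ≥ 1, Rad^i(U) is the inverse limit over N of Rad^i(U_N), and the connecting maps of this inverse system are surjective; (2) for each i ≥ 0, the quotient Rad^i(U)/Rad^{i+1}(U) is isomorphic to the inverse limit over N of Rad^i(U_N)/Rad^{i+1}(U_N). -/

import Mathlib

open scoped Classical
set_option maxHeartbeats 1000000
set_option synthInstance.maxHeartbeats 400000

noncomputable section

namespace ProfiniteBlocks

variable (k : Type) [Field k] (G : Type) [Group G] [TopologicalSpace G]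

/-- Discrete topology on each finite level group algebra. -/
instance (X : Type) : TopologicalSpace (MonoidAlgebra k X) := ⊥

/-- The canonical quotient homomorphism `G/N → G/M` for `N ≤ M`. -/
def qHom (N M : OpenNormalSubgroup G) (h : N ≤ M) :
    G ⧸ N.toSubgroup →* G ⧸ M.toSubgroup :=
  QuotientGroup.map _ _ (MonoidHom.id G) (fun x hx => h hx)

/-- The induced algebra homomorphism `k[G/N] → k[G/M]` for `N ≤ M`. -/
def tHom (N M : OpenNormalSubgroup G) (h : N ≤ M) :
    MonoidAlgebra k (G ⧸ N.toSubgroup) →ₐ[k] MonoidAlgebra k (G ⧸ M.toSubgroup) :=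
  MonoidAlgebra.mapDomainAlgHom k k (qHom G N M h)

/-- The completed group algebra `k⟦G⟧`, realized as the inverse limit of the finite
level group algebras `k[G/N]` over all open normal subgroups `N` of `G`, sitting inside
their product. -/
def CGA : Subalgebra k (∀ N : OpenNormalSubgroup G, MonoidAlgebra k (G ⧸ N.toSubgroup)) where
  carrier := {x | ∀ (N M : OpenNormalSubgroup G) (h : N ≤ M), tHom k G N M h (x N) = x M}
  add_mem' hx hy N M h := by simp [map_add, hx N M h, hy N M h]
  mul_mem' hx hy N M h := by simp [map_mul, hx N M h, hy N M h]
  algebraMap_mem' r N M h := by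
    simp [tHom, MonoidAlgebra.mapDomainAlgHom, MonoidAlgebra.mapDomainRingHom,
      Finsupp.mapDomain_single]

instance : Ring (CGA k G) := inferInstance
instance : Algebra k (CGA k G) := inferInstance

/-- `k⟦G⟧` carries the inverse limit topology (each `k[G/N]` being discrete). -/
instance : TopologicalSpace (CGA k G) := inferInstanceAs (TopologicalSpace (Subtype _))

/-- The canonical (continuous) inclusion of `G` into `k⟦G⟧`. -/
def ofG : G →* CGA k G where
  toFun g := ⟨fun N => MonoidAlgebra.single ((g : G) : G ⧸ N.toSubgroup) 1, by
    intro N M h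
    simp [tHom, MonoidAlgebra.mapDomainAlgHom, MonoidAlgebra.mapDomainRingHom,
      Finsupp.mapDomain_single, qHom, QuotientGroup.map_mk]
    rfl⟩
  map_one' := by
    ext N
    simp [MonoidAlgebra.one_def]
  map_mul' g g' := by
    ext N
    simp [MonoidAlgebra.single_mul_single]


/-- The map between quotient modules induced by `f` (the canonical map whenever
`f` carries `P` into `Q`). -/
def mapQ' {R X Y : Type} [Ring R] [AddCommGroup X] [AddCommGroup Y] [Module R X]
    [Module R Y] (P : Submodule R X) (Q : Submodule R Y) (f : X →ₗ[R] Y) :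
    (X ⧸ P) →ₗ[R] (Y ⧸ Q) :=
  if h : P ≤ Q.comap f then Submodule.mapQ P Q f h else 0

/-- The map between submodules induced by `f` (the canonical restriction whenever
`f` carries `P` into `Q`). -/
def restrict' {R X Y : Type} [Ring R] [AddCommGroup X] [AddCommGroup Y] [Module R X]
    [Module R Y] (P : Submodule R X) (Q : Submodule R Y) (f : X →ₗ[R] Y) :
    P →ₗ[R] Q :=
  if h : ∀ x ∈ P, f x ∈ Q then f.restrict h else 0

/-- The subquotient `W / W'` of a module. -/
abbrev subQuot {R X : Type} [Ring R] [AddCommGroup X] [Module R X]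
    (W W' : Submodule R X) : Type :=
  W ⧸ (W'.comap W.subtype)

/-- The radical of a topological module: the intersection of its maximal open
submodules. -/
def radical (R : Type) [Ring R] (X : Type) [AddCommGroup X] [Module R X]
    [TopologicalSpace X] : Submodule R X :=
  sInf {W : Submodule R X | IsCoatom W ∧ IsOpen (W : Set X)}

/-- Iterated radicals `Rad^i(X)`, with `Rad^0(X) = X`. -/
def radPow (R : Type) [Ring R] (X : Type) [AddCommGroup X] [Module R X]
    [TopologicalSpace X] : ℕ → Submodule R X
  | 0 => ⊤
  | (n + 1) => (radical R (radPow R X n)).map (radPow R X n).subtype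

/-- A topological module is semisimple if every closed submodule has a closed
complement. -/
def IsSemisimpleTop (R : Type) [Ring R] (X : Type) [AddCommGroup X] [Module R X]
    [TopologicalSpace X] : Prop :=
  ∀ W : Submodule R X, IsClosed (W : Set X) →
    ∃ W' : Submodule R X, IsClosed (W' : Set X) ∧ IsCompl W W'

/-- The socle of a topological module: the largest closed semisimple submodule
(defined as the join of all closed semisimple submodules). -/
def socle (R : Type) [Ring R] (X : Type) [AddCommGroup X] [Module R X]
    [TopologicalSpace X] : Submodule R X :=
  sSup {W : Submodule R X | IsClosed (W : Set X) ∧ IsSemisimpleTop R W}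

/-- A module is uniserial if its submodules form a chain. -/
def Uniserial (R : Type) [Ring R] (X : Type) [AddCommGroup X] [Module R X] : Prop :=
  ∀ W W' : Submodule R X, W ≤ W' ∨ W' ≤ W

/-- A topological module is (topologically) indecomposable if it is non-zero and
admits no non-trivial decomposition into closed direct summands. -/
def IsIndecTop (R : Type) [Ring R] (X : Type) [AddCommGroup X] [Module R X]
    [TopologicalSpace X] : Prop :=
  Nontrivial X ∧ ∀ W W' : Submodule R X, IsClosed (W : Set X) → IsClosed (W' : Set X) →
    IsCompl W W' → W = ⊥ ∨ W' = ⊥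

/-- The inverse limit of a compatible system of modules indexed by a preorder,
realized as the submodule of compatible families in the product. -/
def compatLim {ι : Type} [Preorder ι] {R : Type} [Ring R] (T : ι → Type)
    [∀ i, AddCommGroup (T i)] [∀ i, Module R (T i)]
    (t : ∀ i j, i ≤ j → (T i →ₗ[R] T j)) : Submodule R (∀ i, T i) where
  carrier := {f | ∀ (i j : ι) (h : i ≤ j), t i j h (f i) = f j}
  add_mem' ha hb i j h := by simp only [Pi.add_apply, map_add]; rw [ha i j h, hb i j h]
  zero_mem' i j h := by simp
  smul_mem' c a ha i j h := by simp only [Pi.smul_apply, map_smul]; rw [ha i j h]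

/-- `X` has exactly `n` composition factors (measured along the radical series). -/
def HasNFactors (R : Type) [Ring R] (X : Type) [AddCommGroup X] [Module R X]
    [TopologicalSpace X] (n : ℕ) : Prop :=
  radPow R X n = ⊥ ∧ ∀ m < n, radPow R X m ≠ ⊥

/-- `X` has infinitely many composition factors. -/
def HasInfFactors (R : Type) [Ring R] (X : Type) [AddCommGroup X] [Module R X]
    [TopologicalSpace X] : Prop :=
  ∀ n : ℕ, radPow R X n ≠ ⊥



section Coinvariants

variable {k : Type} [Field k] {G : Type} [Group G] [TopologicalSpace G]

variable (k G) in
/-- The (closed) submodule `I_N U` of a topological `k⟦G⟧`-module `U`: the smallest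
closed submodule containing all elements `n • u - u` for `n ∈ N`.  Its quotient is the
module of `N`-coinvariants. -/
def coinvKer (N : OpenNormalSubgroup G) (U : Type) [AddCommGroup U]
    [Module (CGA k G) U] [TopologicalSpace U] : Submodule (CGA k G) U :=
  sInf {W : Submodule (CGA k G) U | IsClosed (W : Set U) ∧
    ∀ n ∈ N.toSubgroup, ∀ u : U, ofG k G n • u - u ∈ W}

variable (k G) in
/-- The module of `N`-coinvariants `U_N` of a topological `k⟦G⟧`-module `U`. -/
abbrev coinv (N : OpenNormalSubgroup G) (U : Type) [AddCommGroup U]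
    [Module (CGA k G) U] [TopologicalSpace U] : Type :=
  U ⧸ coinvKer k G N U

variable (k G) in
/-- The canonical projection `φ_N : U → U_N`. -/
def phi (N : OpenNormalSubgroup G) (U : Type) [AddCommGroup U]
    [Module (CGA k G) U] [TopologicalSpace U] : U →ₗ[CGA k G] coinv k G N U :=
  (coinvKer k G N U).mkQ

lemma coinvKer_mono {N M : OpenNormalSubgroup G} (h : N ≤ M) (U : Type) [AddCommGroup U]
    [Module (CGA k G) U] [TopologicalSpace U] : coinvKer k G N U ≤ coinvKer k G M U :=
  sInf_le_sInf (fun W hW => ⟨hW.1, fun n hn u => hW.2 n (h hn) u⟩)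

variable (k G) in
/-- The canonical projection `φ_{MN} : U_N → U_M` for `N ≤ M`. -/
def phiT (N M : OpenNormalSubgroup G) (h : N ≤ M) (U : Type) [AddCommGroup U]
    [Module (CGA k G) U] [TopologicalSpace U] :
    coinv k G N U →ₗ[CGA k G] coinv k G M U :=
  Submodule.mapQ _ _ LinearMap.id (fun _ hx => coinvKer_mono h U hx)

variable (k G) in
/-- `N` acts trivially on the `k⟦G⟧`-module `W`. -/
def NTrivial (N : OpenNormalSubgroup G) (W : Type) [AddCommGroup W]
    [Module (CGA k G) W] : Prop :=
  ∀ n ∈ N.toSubgroup, ∀ w : W, ofG k G n • w = w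

end Coinvariants

section Pseudocompact

variable (k : Type) [Field k]

/-- A pseudocompact module over a topological `k`-algebra `A`: a Hausdorff topological
module possessing a basis of neighbourhoods of `0` consisting of open submodules of
finite codimension which intersect in `0`, and which is the inverse limit of the
corresponding discrete quotients. -/
structure IsPseudocompactMod (A : Type) [Ring A] [Algebra k A] [TopologicalSpace A]
    (X : Type) [AddCommGroup X] [Module k X] [Module A X] [IsScalarTower k A X]
    [TopologicalSpace X] : Prop where
  t2 : T2Space X
  addGroup : IsTopologicalAddGroup X
  contSMul : ContinuousSMul A X
  basis : (nhds (0 : X)).HasBasis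
    (fun V : Submodule A X => IsOpen (V : Set X) ∧
      FiniteDimensional k (X ⧸ V.restrictScalars k))
    (fun V => (V : Set X))
  inf_bot : (⨅ (V : Submodule A X) (_ : IsOpen (V : Set X) ∧
      FiniteDimensional k (X ⧸ V.restrictScalars k)), V) = ⊥
  complete : ∀ c : ∀ V : {V : Submodule A X // IsOpen (V : Set X) ∧
      FiniteDimensional k (X ⧸ V.restrictScalars k)}, X ⧸ V.1,
    (∀ (V W : {V : Submodule A X // IsOpen (V : Set X) ∧
        FiniteDimensional k (X ⧸ V.restrictScalars k)}), V.1 ≤ W.1 →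
      mapQ' V.1 W.1 LinearMap.id (c V) = c W) →
    ∃ x : X, ∀ V, c V = Submodule.Quotient.mk x

end Pseudocompact

section Blocks

variable (R : Type) [Ring R]

/-- A block idempotent: a centrally primitive idempotent of `R`. -/
structure IsBlockIdem (e : R) : Prop where
  idem : IsIdempotentElem e
  ne_zero : e ≠ 0
  central : e ∈ Set.center R
  primitive : ∀ f g : R, f ∈ Set.center R → g ∈ Set.center R → IsIdempotentElem f →
    IsIdempotentElem g → f * g = 0 → g * f = 0 → e = f + g → f = 0 ∨ g = 0

/-- The block `B = Re` determined by a central idempotent `e`, as a left `R`-module. -/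
def blockMod (e : R) (he : e ∈ Set.center R) : Submodule R R where
  carrier := {a : R | a * e = a}
  add_mem' := by intro a b ha hb; simp only [Set.mem_setOf_eq, add_mul] at *; rw [ha, hb]
  zero_mem' := by simp
  smul_mem' := by
    intro c a ha
    simp only [Set.mem_setOf_eq, smul_eq_mul, mul_assoc] at *
    rw [ha]

/-- A module belongs to the block of the central idempotent `e` if `e` acts as the
identity on it. -/
def InBlock {X : Type} [AddCommGroup X] [Module R X] (e : R) : Prop :=
  ∀ x : X, e • x = x

end Blocks

section Defect

variable {k : Type} [Field k] {G : Type} [Group G] [TopologicalSpace G]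

variable (k G) in
/-- The conjugation action of `G` on `k⟦G⟧`. -/
def conjAct (g : G) (x : CGA k G) : CGA k G :=
  ofG k G g * x * ofG k G g⁻¹

variable (k G) in
/-- The `H`-fixed points of `k⟦G⟧` under conjugation. -/
def fixedBy (H : Subgroup G) : Set (CGA k G) :=
  {x : CGA k G | ∀ h ∈ H, conjAct k G h x = x}

variable (k G) in
/-- The relative trace map `Tr_H^G` on `k⟦G⟧` (a finite sum over coset
representatives when `H` is open). -/
def trMap (H : Subgroup G) (x : CGA k G) : CGA k G :=
  ∑ᶠ c : G ⧸ H, conjAct k G (Quotient.out c) x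

variable (k G) in
/-- The image `Tr_H^G(k⟦G⟧^H)`. -/
def trImage (H : Subgroup G) : Set (CGA k G) :=
  trMap k G H '' fixedBy k G H

variable (k G) in
/-- `D` satisfies the defect property for `e`:
`e ∈ ⋂_N Tr_{DN}^G (k⟦G⟧^{DN})`. -/
def DefectProp (e : CGA k G) (D : Subgroup G) : Prop :=
  ∀ N : OpenNormalSubgroup G, e ∈ trImage k G (D ⊔ N.toSubgroup)

variable (k G) in
/-- `D` is a defect group of the block of `e`: a closed subgroup, minimal subject to
the defect property. -/
structure IsDefectGroup (e : CGA k G) (D : Subgroup G) : Prop where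
  closed : IsClosed (D : Set G)
  defect : DefectProp k G e D
  minimal : ∀ D' : Subgroup G, IsClosed ((D' : Set G)) → D' ≤ D →
    DefectProp k G e D' → D' = D

end Defect

section FiniteDefect

variable (k : Type) [Field k] (Q : Type) [Group Q]

/-- Conjugation on a finite level group algebra `k[Q]`. -/
def conjActF (q : Q) (x : MonoidAlgebra k Q) : MonoidAlgebra k Q :=
  MonoidAlgebra.single q 1 * x * MonoidAlgebra.single q⁻¹ 1

/-- `H`-fixed points of `k[Q]` under conjugation. -/
def fixedByF (H : Subgroup Q) : Set (MonoidAlgebra k Q) :=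
  {x | ∀ h ∈ H, conjActF k Q h x = x}

/-- The relative trace map `Tr_H^Q` on `k[Q]`. -/
def trMapF (H : Subgroup Q) (x : MonoidAlgebra k Q) : MonoidAlgebra k Q :=
  ∑ᶠ c : Q ⧸ H, conjActF k Q (Quotient.out c) x

/-- The image `Tr_H^Q(k[Q]^H)`. -/
def trImageF (H : Subgroup Q) : Set (MonoidAlgebra k Q) :=
  trMapF k Q H '' fixedByF k Q H

/-- `Dq` is a defect group of the block of `e` in the group algebra `k[Q]`. -/
structure IsDefectGroupF (e : MonoidAlgebra k Q) (Dq : Subgroup Q) : Prop where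
  defect : e ∈ trImageF k Q Dq
  minimal : ∀ D' : Subgroup Q, D' ≤ Dq → e ∈ trImageF k Q D' → D' = Dq

end FiniteDefect

section CyclicDefect

variable {k : Type} [Field k] {G : Type} [Group G] [TopologicalSpace G]

variable (G) in
/-- A subgroup is procyclic if it possesses a dense cyclic (abstract) subgroup. -/
def IsProcyclic (D : Subgroup G) : Prop :=
  ∃ g : G, closure ((Subgroup.zpowers g : Subgroup G) : Set G) = (D : Set G)

variable (G) in
/-- `D` is isomorphic, as a topological group, to the `p`-adic integers `ℤ_p`. -/
def IsZpGroup (p : ℕ) [Fact p.Prime] (D : Subgroup G) : Prop :=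
  ∃ φ : D ≃ₜ Multiplicative ℤ_[p], ∀ x y : D, φ (x * y) = φ x * φ y

variable (G) in
/-- `D` is a cyclic pro-`p` group: either a finite cyclic `p`-group or `ℤ_p`. -/
def IsCyclicProP (p : ℕ) [Fact p.Prime] (D : Subgroup G) : Prop :=
  (Finite D ∧ IsPGroup p D ∧ IsCyclic D) ∨ IsZpGroup G p D

end CyclicDefect

section Simples

variable {k : Type} [Field k] {G : Type} [Group G] [TopologicalSpace G]

variable (k G) in
/-- The projection `k⟦G⟧ → k[G/N]`. -/
def projN (N : OpenNormalSubgroup G) (x : CGA k G) :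
    MonoidAlgebra k (G ⧸ N.toSubgroup) :=
  (x : ∀ N : OpenNormalSubgroup G, MonoidAlgebra k (G ⧸ N.toSubgroup)) N

variable (k G) in
/-- `N` acts trivially on every simple module of the block of `e`. -/
def TrivOnSimples (e : CGA k G) (N : OpenNormalSubgroup G) : Prop :=
  ∀ (S : Type) [AddCommGroup S] [Module (CGA k G) S],
    IsSimpleModule (CGA k G) S → InBlock (CGA k G) (X := S) e → NTrivial k G N S

variable (k G) in
/-- Membership of `N` in the standard cofinal system `𝒩` for the block `B` of `e`
with defect group `D`: the coinvariant algebra `B_N` is a block of `k[G/N]` with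
defect group `DN/N`, and `N` acts trivially on every simple `B`-module. -/
structure GoodN (e : CGA k G) (D : Subgroup G) (N : OpenNormalSubgroup G) : Prop where
  blockN : IsBlockIdem (MonoidAlgebra k (G ⧸ N.toSubgroup)) (projN k G N e)
  defectN : IsDefectGroupF k (G ⧸ N.toSubgroup) (projN k G N e)
    (D.map (QuotientGroup.mk' N.toSubgroup))
  triv : TrivOnSimples k G e N

/-- A cofinal set of open normal subgroups. -/
def IsCofinal {G : Type} [Group G] [TopologicalSpace G]
    (𝒩 : Set (OpenNormalSubgroup G)) : Prop :=
  ∀ M : OpenNormalSubgroup G, ∃ N ∈ 𝒩, N ≤ M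

variable (k G) in
/-- A pseudocompact module is pro-uniserial (w.r.t. the cofinal system `𝒩`) if all
its coinvariant quotients at members of `𝒩` are uniserial. -/
def ProUniserial (𝒩 : Set (OpenNormalSubgroup G)) (U : Type) [AddCommGroup U]
    [Module (CGA k G) U] [TopologicalSpace U] : Prop :=
  ∀ N ∈ 𝒩, Uniserial (CGA k G) (coinv k G N U)

variable (k G) in
/-- `S` is a composition factor of the pseudocompact module `U`: it is a composition
factor of some finite coinvariant quotient `U_N`. -/
def IsCompFactorOf (U : Type) [AddCommGroup U] [Module (CGA k G) U]
    [TopologicalSpace U] (S : Type) [AddCommGroup S] [Module (CGA k G) S] : Prop :=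
  ∃ (N : OpenNormalSubgroup G) (W W' : Submodule (CGA k G) (coinv k G N U)),
    W' ≤ W ∧ Nonempty (subQuot W W' ≃ₗ[CGA k G] S)

variable (k G) in
/-- `S` is a composition factor of the finite-dimensional module `X`. -/
def IsCompFactorFin (X : Type) [AddCommGroup X] [Module (CGA k G) X]
    (S : Type) [AddCommGroup S] [Module (CGA k G) S] : Prop :=
  ∃ W W' : Submodule (CGA k G) X, W' ≤ W ∧ Nonempty (subQuot W W' ≃ₗ[CGA k G] S)

end Simples

section Projective

variable {k : Type} [Field k] {G : Type} [Group G] [TopologicalSpace G]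

variable (k G) in
/-- A pseudocompact `k⟦G⟧`-module is (categorically) projective if every continuous
surjection onto it from a pseudocompact module splits. -/
def IsPCProjective (P : Type) [AddCommGroup P] [Module (CGA k G) P]
    [TopologicalSpace P] : Prop :=
  ∀ (W : Type) [AddCommGroup W] [Module k W] [Module (CGA k G) W]
    [IsScalarTower k (CGA k G) W] [TopologicalSpace W],
    IsPseudocompactMod k (CGA k G) W →
    ∀ f : W →ₗ[CGA k G] P, Continuous f → Function.Surjective f →
      ∃ s : P →ₗ[CGA k G] W, Continuous s ∧ f.comp s = LinearMap.id

variable (k G) in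
/-- `P` is a projective cover of the simple module `S` in the block of `e`:
a pseudocompact projective module of the block together with a surjection onto `S`
whose kernel is superfluous (contained in the radical). -/
structure IsProjCover (e : CGA k G) (P : Type) [AddCommGroup P] [Module k P]
    [Module (CGA k G) P] [IsScalarTower k (CGA k G) P] [TopologicalSpace P]
    (S : Type) [AddCommGroup S] [Module (CGA k G) S] : Prop where
  pseudocompact : IsPseudocompactMod k (CGA k G) P
  inBlock : InBlock (CGA k G) (X := P) e
  projective : IsPCProjective k G P
  cover : ∃ π : P →ₗ[CGA k G] S, Function.Surjective π ∧
    LinearMap.ker π ≤ radical (CGA k G) P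

end Projective




/-- The map between subquotients induced by `f`. -/
def subQuotMap {R X Y : Type} [Ring R] [AddCommGroup X] [AddCommGroup Y] [Module R X]
    [Module R Y] (W W' : Submodule R X) (V V' : Submodule R Y) (f : X →ₗ[R] Y) :
    subQuot W W' →ₗ[R] subQuot V V' :=
  mapQ' (W'.comap W.subtype) (V'.comap V.subtype) (restrict' W V f)

/-- The conditions of Proposition 3.8 on a pair of pro-uniserial submodules `X`, `Y`
of an indecomposable projective `P`: `X ∩ Y = Soc(P)`, `X + Y = Rad(P)`, and
`Rad(P)/Soc(P) ≅ X/Soc(P) ⊕ Y/Soc(P)` with no common composition factors. -/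
def ProUniserialPair (k : Type) [Field k] (G : Type) [Group G] [TopologicalSpace G]
    (𝒩 : Set (OpenNormalSubgroup G)) (P : Type) [AddCommGroup P]
    [Module (CGA k G) P] [TopologicalSpace P]
    (X Y : Submodule (CGA k G) P) : Prop :=
  ProUniserial k G 𝒩 X ∧ ProUniserial k G 𝒩 Y ∧
  X ⊓ Y = socle (CGA k G) P ∧
  X ⊔ Y = radical (CGA k G) P ∧
  Nonempty ((subQuot (radical (CGA k G) P) (socle (CGA k G) P)) ≃ₗ[CGA k G]
    (subQuot X (socle (CGA k G) P) × subQuot Y (socle (CGA k G) P))) ∧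
  ∀ (T : Type) [AddCommGroup T] [Module (CGA k G) T], IsSimpleModule (CGA k G) T →
    ¬ (IsCompFactorOf k G (subQuot X (socle (CGA k G) P)) T ∧
       IsCompFactorOf k G (subQuot Y (socle (CGA k G) P)) T)

/-- `S : ι → Type` is a complete set of pairwise non-isomorphic representatives of
the simple modules of the block of `e`. -/
def IsSimpleReps (k : Type) [Field k] (G : Type) [Group G] [TopologicalSpace G]
    (e : CGA k G) {ι : Type} (S : ι → Type) [∀ i, AddCommGroup (S i)]
    [∀ i, Module (CGA k G) (S i)] : Prop :=
  (∀ i, IsSimpleModule (CGA k G) (S i) ∧ InBlock (CGA k G) (X := S i) e) ∧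
  (∀ i j, i ≠ j → IsEmpty (S i ≃ₗ[CGA k G] S j)) ∧
  (∀ (T : Type) [AddCommGroup T] [Module (CGA k G) T],
    IsSimpleModule (CGA k G) T → InBlock (CGA k G) (X := T) e →
      ∃ i, Nonempty (T ≃ₗ[CGA k G] S i))

section Brauer

/-- The size of the `ρ`-orbit of `i` (the number of edges at the corresponding vertex
of the Brauer tree). -/
def orbSize {ι : Type} (ρ : Equiv.Perm ι) (i : ι) : ℕ :=
  Function.minimalPeriod ρ i

/-- Data describing the exceptional vertex of a Brauer tree: `none` if there is no
exceptional vertex, and otherwise a flag recording whether it is a `ρ`-vertex or a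
`σ`-vertex together with an edge adjacent to it. -/
abbrev ExcVertex (ι : Type) : Type := Option (Bool × ι)

/-- The edge `i` is adjacent to the exceptional vertex, its `ρ`-endpoint being
exceptional. -/
def AdjExcRho {ι : Type} (ρ : Equiv.Perm ι) (exc : ExcVertex ι) (i : ι) : Prop :=
  ∃ j : ι, exc = some (true, j) ∧ ρ.SameCycle j i

/-- The edge `i` is adjacent to the exceptional vertex, its `σ`-endpoint being
exceptional. -/
def AdjExcSigma {ι : Type} (σ : Equiv.Perm ι) (exc : ExcVertex ι) (i : ι) : Prop :=
  ∃ j : ι, exc = some (false, j) ∧ σ.SameCycle j i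

/-- The edge `i` is adjacent to the exceptional vertex. -/
def AdjExc {ι : Type} (ρ σ : Equiv.Perm ι) (exc : ExcVertex ι) (i : ι) : Prop :=
  AdjExcRho ρ exc i ∨ AdjExcSigma σ exc i

end Brauer


section LinearCompactness

open Topology Filter

/-- A linearly compact module with a neighbourhood basis of open submodules of Artinian
quotient. -/
structure LinComp (R X : Type) [Ring R] [AddCommGroup X] [Module R X]
    [TopologicalSpace X] : Prop where
  t2 : T2Space X
  addGroup : IsTopologicalAddGroup X
  basis : (𝓝 (0 : X)).HasBasis (fun V : Submodule R X => IsOpen (V : Set X))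
    (fun V => (V : Set X))
  artinian : ∀ V : Submodule R X, IsOpen (V : Set X) → IsArtinian R (X ⧸ V)
  inter : ∀ {ι : Type} (x : ι → X) (W : ι → Submodule R X),
    (∀ i, IsClosed (W i : Set X)) → (∀ s : Finset ι, ∃ y, ∀ i ∈ s, y - x i ∈ W i) →
    ∃ y, ∀ i, y - x i ∈ W i

section Basis

variable {R X : Type} [Ring R] [AddCommGroup X] [Module R X] [TopologicalSpace X]

/-- A family of cosets (given by a representative and a submodule) of closed submodules with
the finite intersection property. -/
def IsCosetFIP (S : Set (X × Submodule R X)) : Prop :=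
  (∀ q ∈ S, IsClosed (q.2 : Set X)) ∧
    ∀ t : Finset (X × Submodule R X), (t : Set _) ⊆ S → ∃ y, ∀ q ∈ t, y - q.1 ∈ q.2

lemma exists_maximal_isCosetFIP {S : Set (X × Submodule R X)} (hS : IsCosetFIP S) :
    ∃ T, S ⊆ T ∧ Maximal IsCosetFIP T := by
  refine zorn_subset_nonempty {T | IsCosetFIP T} ?_ S hS
  intro c hc hchain hne
  refine ⟨⋃₀ c, ⟨?_, ?_⟩, fun s hs => Set.subset_sUnion_of_mem hs⟩
  · rintro q ⟨T, hT, hq⟩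
    exact (hc hT).1 q hq
  · intro t ht
    obtain ⟨T, hT, htT⟩ := hchain.directedOn.exists_mem_subset_of_finset_subset_biUnion
      hne (f := id) (by simpa [Set.sUnion_eq_biUnion] using ht)
    exact (hc hT).2 t htT

lemma mem_of_maximal_isCosetFIP {S : Set (X × Submodule R X)} (hS : Maximal IsCosetFIP S)
    {q : X × Submodule R X} (hq : IsClosed (q.2 : Set X))
    (h : ∀ t : Finset (X × Submodule R X), (t : Set _) ⊆ S →
      ∃ y, y - q.1 ∈ q.2 ∧ ∀ r ∈ t, y - r.1 ∈ r.2) : q ∈ S := by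
  have key : IsCosetFIP (insert q S) := by
    refine ⟨?_, fun t ht => ?_⟩
    · rintro r (rfl | hr)
      exacts [hq, hS.prop.1 r hr]
    · obtain ⟨y, hy, hy'⟩ := h (t.erase q) (by
        intro r hr
        simp only [Finset.coe_erase, Set.mem_sdiff, Finset.mem_coe, Set.mem_singleton_iff] at hr
        exact (ht hr.1).resolve_left hr.2)
      refine ⟨y, fun r hr => ?_⟩
      by_cases hrq : r = q
      · exact hrq ▸ hy
      · exact hy' r (Finset.mem_erase.2 ⟨hrq, hr⟩)
  exact hS.le_of_ge key (Set.subset_insert q S) (Set.mem_insert q S)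

variable [IsTopologicalAddGroup X]

lemma mem_of_isClosed_of_basis {p : Submodule R X → Prop}
    (hp : (𝓝 (0 : X)).HasBasis p (fun V => (V : Set X)))
    {C : Submodule R X} (hC : IsClosed (C : Set X)) {x : X}
    (h : ∀ V, p V → ∃ c ∈ C, c - x ∈ V) : x ∈ C := by
  rw [← SetLike.mem_coe, ← hC.closure_eq, mem_closure_iff_nhds]
  intro t ht
  have h0 : (fun z => z + x) ⁻¹' t ∈ 𝓝 (0 : X) := by
    apply (continuous_add_const x).continuousAt.preimage_mem_nhds
    simpa using ht
  obtain ⟨V, hV, hVt⟩ := hp.mem_iff.1 h0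
  obtain ⟨c, hc, hcV⟩ := h V hV
  exact ⟨c, by simpa using hVt hcV, hc⟩

lemma isClosed_of_isOpen_submodule {V : Submodule R X} (hV : IsOpen (V : Set X)) :
    IsClosed (V : Set X) :=
  AddSubgroup.isClosed_of_isOpen V.toAddSubgroup hV

lemma isOpen_submodule_mono {V W : Submodule R X} (hV : IsOpen (V : Set X)) (h : V ≤ W) :
    IsOpen (W : Set X) :=
  AddSubgroup.isOpen_mono (H₁ := V.toAddSubgroup) (H₂ := W.toAddSubgroup) h hV

lemma exists_mem_of_maximal_isCosetFIP {S : Set (X × Submodule R X)}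
    (hS : Maximal IsCosetFIP S) {V : Submodule R X} (hV : IsOpen (V : Set X))
    [IsArtinian R (X ⧸ V)] : ∃ x, (x, V) ∈ S := by
  have htop : ((0 : X), (⊤ : Submodule R X)) ∈ S := by
    refine mem_of_maximal_isCosetFIP hS isClosed_univ fun t ht => ?_
    obtain ⟨y, hy⟩ := hS.prop.2 t ht
    exact ⟨y, trivial, hy⟩
  obtain ⟨_, ⟨q, hq, rfl⟩, hmin⟩ := IsArtinian.set_has_minimal
    ((fun q : X × Submodule R X => q.2.map V.mkQ) '' S) ⟨_, _, htop, rfl⟩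
  refine ⟨q.1, mem_of_maximal_isCosetFIP hS (isClosed_of_isOpen_submodule hV) fun t ht => ?_⟩
  have hins : ((insert q t : Finset _) : Set (X × Submodule R X)) ⊆ S := by
    rw [Finset.coe_insert]; exact Set.insert_subset hq ht
  obtain ⟨y₀, hy₀⟩ := hS.prop.2 _ hins
  let W : Submodule R X := ⨅ r ∈ insert q t, r.2
  have hWmem : ∀ r ∈ insert q t, W ≤ r.2 := fun r hr => iInf₂_le r hr
  have hW : (y₀, W) ∈ S := by
    refine mem_of_maximal_isCosetFIP hS ?_ fun t' ht' => ?_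
    · simp only [W, Submodule.coe_iInf]
      exact isClosed_biInter fun r hr => hS.prop.1 r (hins hr)
    · obtain ⟨y, hy⟩ := hS.prop.2 (insert q t ∪ t') (by
        rw [Finset.coe_union]; exact Set.union_subset hins ht')
      refine ⟨y, ?_, fun r hr => hy r (Finset.mem_union_right _ hr)⟩
      simp only [W, Submodule.mem_iInf]
      intro r hr
      have := r.2.sub_mem (hy r (Finset.mem_union_left _ hr)) (hy₀ r hr)
      simpa using this
  have hle : W.map V.mkQ ≤ q.2.map V.mkQ :=
    Submodule.map_mono (hWmem q (Finset.mem_insert_self _ _))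
  have heq : W.map V.mkQ = q.2.map V.mkQ := by
    by_contra hne
    exact hmin _ ⟨_, hW, rfl⟩ (lt_of_le_of_ne hle hne)
  have hmem : V.mkQ (y₀ - q.1) ∈ W.map V.mkQ :=
    heq ▸ Submodule.mem_map_of_mem (hy₀ q (Finset.mem_insert_self _ _))
  obtain ⟨w, hw, hwV⟩ := hmem
  refine ⟨y₀ - w, ?_, fun r hr => ?_⟩
  · have : V.mkQ (y₀ - q.1 - w) = 0 := by rw [map_sub, hwV, sub_self]
    rw [← LinearMap.mem_ker, Submodule.ker_mkQ] at this
    convert this using 1; abel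
  · have := r.2.sub_mem (hy₀ r (Finset.mem_insert_of_mem hr))
      (hWmem r (Finset.mem_insert_of_mem hr) hw)
    convert this using 1; abel

/-- A complete module with a basis of open submodules of Artinian quotient is linearly
compact. -/
lemma LinComp.of_complete [T2Space X] {p : Submodule R X → Prop}
    (hp : (𝓝 (0 : X)).HasBasis p (fun V => (V : Set X)))
    (hopen : ∀ V, p V → IsOpen (V : Set X))
    (hart : ∀ V, p V → IsArtinian R (X ⧸ V))
    (hcomplete : ∀ c : {V // p V} → X, (∀ V W, V.1 ≤ W.1 → c V - c W ∈ W.1) →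
      ∃ x, ∀ V, x - c V ∈ V.1) : LinComp R X where
  t2 := inferInstance
  addGroup := inferInstance
  basis := hp.to_hasBasis (fun V hV => ⟨V, hopen V hV, le_rfl⟩)
    (fun V hV => hp.mem_iff.1 (hV.mem_nhds V.zero_mem))
  artinian V hV := by
    obtain ⟨W, hW, hWV⟩ := hp.mem_iff.1 (hV.mem_nhds V.zero_mem)
    have := hart W hW
    exact isArtinian_of_surjective _ (Submodule.factor (show W ≤ V from hWV))
      (Submodule.factor_surjective _)
  inter := by
    intro ι x W hW hfip
    obtain ⟨S, hsub, hS⟩ := exists_maximal_isCosetFIP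
      (S := Set.range fun i => (x i, W i)) ⟨by rintro _ ⟨i, rfl⟩; exact hW i, fun t ht => by
        rw [← Set.image_univ, Finset.subset_set_image_iff] at ht
        obtain ⟨s, -, rfl⟩ := ht
        simpa using hfip s⟩
    choose c hc using fun V : {V // p V} =>
      haveI := hart V.1 V.2
      exists_mem_of_maximal_isCosetFIP hS (hopen V.1 V.2)
    obtain ⟨y, hy⟩ := hcomplete c fun V V' h => by
      obtain ⟨z, hz⟩ := hS.prop.2 {(c V, V.1), (c V', V'.1)} (by
        intro r hr
        simp only [Finset.coe_insert, Finset.coe_singleton, Set.mem_insert_iff,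
          Set.mem_singleton_iff] at hr
        rcases hr with rfl | rfl
        exacts [hc V, hc V'])
      have h1 := h (hz (c V, V.1) (by simp))
      have h2 := hz (c V', V'.1) (by simp)
      simpa using V'.1.sub_mem h2 h1
    refine ⟨y, fun i => mem_of_isClosed_of_basis hp (hW i) fun V hV => ?_⟩
    obtain ⟨z, hz⟩ := hS.prop.2 {(c ⟨V, hV⟩, V), (x i, W i)} (by
      intro r hr
      simp only [Finset.coe_insert, Finset.coe_singleton, Set.mem_insert_iff,
        Set.mem_singleton_iff] at hr
      rcases hr with rfl | rfl
      exacts [hc ⟨V, hV⟩, hsub ⟨i, rfl⟩])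
    refine ⟨z - x i, hz (x i, W i) (by simp), ?_⟩
    have h1 := hz (c ⟨V, hV⟩, V) (by simp)
    have h2 := hy ⟨V, hV⟩
    simpa using V.sub_mem h1 h2

end Basis

namespace LinComp

variable {R X Y : Type} [Ring R] [AddCommGroup X] [Module R X] [TopologicalSpace X]
  [AddCommGroup Y] [Module R Y] [TopologicalSpace Y]

lemma submodule (hX : LinComp R X) {C : Submodule R X} (hC : IsClosed (C : Set X)) :
    LinComp R C := by
  have := hX.t2
  have := hX.addGroup
  have hemb : IsClosedEmbedding (C.subtype : C → X) := hC.isClosedEmbedding_subtypeVal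
  refine ⟨inferInstance, inferInstance, ?_, ?_, ?_⟩
  · have hb := hX.basis.comap (C.subtype : C → X)
    rw [← C.subtype.map_zero, ← hemb.isInducing.nhds_eq_comap] at hb
    exact hb.to_hasBasis
      (fun V hV => ⟨V.comap C.subtype, hV.preimage hemb.continuous, le_rfl⟩)
      (fun V hV => hb.mem_iff.1 (hV.mem_nhds V.zero_mem))
  · intro V hV
    obtain ⟨V', hV', hle⟩ := (hX.basis.comap (C.subtype : C → X)).mem_iff.1 (by
      rw [← C.subtype.map_zero, ← hemb.isInducing.nhds_eq_comap]
      exact hV.mem_nhds V.zero_mem)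
    have := hX.artinian V' hV'
    have : IsArtinian R (C ⧸ V'.comap C.subtype) :=
      isArtinian_of_injective (Submodule.mapQ _ V' C.subtype le_rfl) (by
        rw [← LinearMap.ker_eq_bot, Submodule.ker_mapQ, Submodule.mkQ_map_self])
    exact isArtinian_of_surjective _ (Submodule.factor (show V'.comap C.subtype ≤ V from hle))
      (Submodule.factor_surjective _)
  · intro ι x W hW hfip
    obtain ⟨y, hy⟩ := hX.inter (ι := Option ι)
      (fun o => o.elim 0 fun i => (x i : X)) (fun o => o.elim C fun i => (W i).map C.subtype)
      (by
        rintro (_ | i)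
        · exact hC
        · simpa using hemb.isClosedMap _ (hW i))
      (by
        intro s
        obtain ⟨y, hy⟩ := hfip s.eraseNone
        refine ⟨y, ?_⟩
        rintro (_ | i) hi
        · simp
        · exact ⟨y - x i, hy i (by simpa using hi), rfl⟩)
    have hyC : y ∈ C := by simpa using hy none
    refine ⟨⟨y, hyC⟩, fun i => ?_⟩
    obtain ⟨w, hw, hwy⟩ := hy (some i)
    have hwx : (⟨y, hyC⟩ : C) - x i = w := Subtype.ext hwy.symm
    rwa [hwx]

lemma quotient (hX : LinComp R X) {C : Submodule R X} (hC : IsClosed (C : Set X)) :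
    LinComp R (X ⧸ C) := by
  have := hX.t2
  have := hX.addGroup
  have hq := C.isOpenQuotientMap_mkQ
  refine ⟨inferInstance, inferInstance, ?_, ?_, ?_⟩
  · refine ⟨fun t => ⟨fun ht => ?_, fun ⟨V, hV, hVt⟩ =>
      mem_of_superset (hV.mem_nhds V.zero_mem) hVt⟩⟩
    obtain ⟨V, hV, hVt⟩ := hX.basis.mem_iff.1
      (hq.continuous.continuousAt.preimage_mem_nhds (by simpa using ht) : C.mkQ ⁻¹' t ∈ 𝓝 0)
    refine ⟨V.map C.mkQ, ?_, ?_⟩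
    · rw [Submodule.map_coe]; exact hq.isOpenMap _ hV
    · rw [Submodule.map_coe]; exact Set.image_subset_iff.2 hVt
  · intro V hV
    have := hX.artinian (V.comap C.mkQ) (hV.preimage hq.continuous)
    refine isArtinian_of_surjective _ (Submodule.mapQ (V.comap C.mkQ) V C.mkQ le_rfl) ?_
    intro z
    obtain ⟨z, rfl⟩ := V.mkQ_surjective z
    obtain ⟨z, rfl⟩ := C.mkQ_surjective z
    exact ⟨Submodule.Quotient.mk z, rfl⟩
  · intro ι x W hW hfip
    choose x' hx' using fun i => C.mkQ_surjective (x i)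
    obtain ⟨y, hy⟩ := hX.inter x' (fun i => (W i).comap C.mkQ)
      (fun i => (hW i).preimage hq.continuous) (by
        intro s
        obtain ⟨y, hy⟩ := hfip s
        obtain ⟨y, rfl⟩ := C.mkQ_surjective y
        exact ⟨y, fun i hi => by simpa only [Submodule.mem_comap, map_sub, hx'] using hy i hi⟩)
    exact ⟨C.mkQ y, fun i => by simpa only [Submodule.mem_comap, map_sub, hx'] using hy i⟩

lemma exists_mem_of_directed (hX : LinComp R X) {C : Submodule R X}
    (hC : IsClosed (C : Set X)) {ι : Type} [Nonempty ι] (K : ι → Submodule R X)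
    (hK : ∀ i, IsClosed (K i : Set X)) (z : ι → X) (hz : ∀ i, z i ∈ C)
    (hdir : ∀ i j, ∃ l, (K l ≤ K i ∧ z l - z i ∈ K i) ∧ (K l ≤ K j ∧ z l - z j ∈ K j)) :
    ∃ y ∈ C, ∀ i, y - z i ∈ K i := by
  let r : X × Submodule R X → X × Submodule R X → Prop := fun a b => b.2 ≤ a.2 ∧ b.1 - a.1 ∈ a.2
  have : IsTrans _ r := ⟨fun a b c hab hbc =>
    ⟨hbc.1.trans hab.1, by simpa using a.2.add_mem (hab.1 hbc.2) hab.2⟩⟩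
  have hd : Directed r fun i => (z i, K i) := hdir
  obtain ⟨y, hy⟩ := hX.inter z (fun i => K i ⊓ C)
    (fun i => by rw [Submodule.coe_inf]; exact (hK i).inter hC) (fun s => by
      obtain ⟨l, hl⟩ := hd.finset_le s
      exact ⟨z l, fun i hi => ⟨(hl i hi).2, C.sub_mem (hz l) (hz i)⟩⟩)
  obtain ⟨i⟩ := ‹Nonempty ι›
  exact ⟨y, by simpa using C.add_mem (hy i).2 (hz i), fun i => (hy i).1⟩

lemma exists_le_of_iInf_le (hX : LinComp R X) {ι : Type} [Nonempty ι]
    {K : ι → Submodule R X} (hK : ∀ i, IsClosed (K i : Set X)) (hdir : Directed (· ≥ ·) K)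
    {V : Submodule R X} (hV : IsClosed (V : Set X)) [IsArtinian R (X ⧸ V)]
    (h : ⨅ i, K i ≤ V) : ∃ i, K i ≤ V := by
  obtain ⟨_, ⟨n, rfl⟩, hmin⟩ := IsArtinian.set_has_minimal
    (Set.range fun i => (K i).map V.mkQ) (Set.range_nonempty _)
  refine ⟨n, fun x hx => ?_⟩
  have key : ∀ i, ∃ z ∈ K i, z - x ∈ V := by
    intro i
    obtain ⟨l, hli, hln⟩ := hdir i n
    have heq : (K l).map V.mkQ = (K n).map V.mkQ := by
      by_contra hne
      exact hmin _ ⟨l, rfl⟩ (lt_of_le_of_ne (Submodule.map_mono hln) hne)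
    obtain ⟨z, hz, hzx⟩ : V.mkQ x ∈ (K l).map V.mkQ := heq ▸ Submodule.mem_map_of_mem hx
    exact ⟨z, hli hz, (Submodule.Quotient.eq V).1 hzx⟩
  choose z hz hzx using key
  obtain ⟨y, -, hy⟩ := hX.exists_mem_of_directed (C := ⊤) isClosed_univ (fun i => V ⊓ K i)
    (fun i => by rw [Submodule.coe_inf]; exact hV.inter (hK i)) z (fun _ => trivial) (by
      intro i j
      obtain ⟨l, hli, hlj⟩ := hdir i j
      have hzz : ∀ i, z l - z i ∈ V := fun i => by
        simpa using V.sub_mem (hzx l) (hzx i)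
      exact ⟨l, ⟨inf_le_inf_left _ hli, hzz i, (K i).sub_mem (hli (hz l)) (hz i)⟩,
        ⟨inf_le_inf_left _ hlj, hzz j, (K j).sub_mem (hlj (hz l)) (hz j)⟩⟩)
  have hyV : y ∈ V := h <| Submodule.mem_iInf _ |>.2 fun i => by
    simpa using (K i).add_mem (hy i).2 (hz i)
  have := V.sub_mem hyV (V.add_mem (hy n).1 (hzx n))
  simpa using this

lemma isClosed_map (hX : LinComp R X) (hY : LinComp R Y) {f : X →ₗ[R] Y} (hf : Continuous f)
    {C : Submodule R X} (hC : IsClosed (C : Set X)) : IsClosed (C.map f : Set Y) := by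
  have := hX.addGroup
  have := hY.addGroup
  have := hY.t2
  have hbot : ⨅ V : {V : Submodule R Y // IsOpen (V : Set Y)}, V.1 = ⊥ := by
    refine (Submodule.eq_bot_iff _).2 fun y hy => ?_
    refine mem_of_isClosed_of_basis (C := ⊥) hY.basis (by simp) fun V hV => ⟨0, by simp, ?_⟩
    simpa using (Submodule.mem_iInf _).1 hy ⟨V, hV⟩
  refine isClosed_of_closure_subset fun y hy => ?_
  have key : ∀ V : {V : Submodule R Y // IsOpen (V : Set Y)}, ∃ c ∈ C, f c - y ∈ V.1 := by
    intro V
    have ho : IsOpen ((fun z => z - y) ⁻¹' (V.1 : Set Y)) :=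
      V.2.preimage (continuous_id.sub continuous_const)
    obtain ⟨_, hcV, c, hc, rfl⟩ := mem_closure_iff.1 hy _ ho (by simp)
    exact ⟨c, hc, hcV⟩
  choose z hz hzy using key
  have : Nonempty {V : Submodule R Y // IsOpen (V : Set Y)} := ⟨⟨⊤, isOpen_univ⟩⟩
  obtain ⟨c, hc, hcz⟩ := hX.exists_mem_of_directed hC
    (fun V : {V : Submodule R Y // IsOpen (V : Set Y)} => V.1.comap f)
    (fun V => (isClosed_of_isOpen_submodule V.2).preimage hf) z hz (by
      intro V W
      have hsub : ∀ A B : {V : Submodule R Y // IsOpen (V : Set Y)}, A.1 ≤ B.1 →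
          z A - z B ∈ B.1.comap f := fun A B hAB => by
        simpa using B.1.sub_mem (hAB (hzy A)) (hzy B)
      refine ⟨⟨V.1 ⊓ W.1, by rw [Submodule.coe_inf]; exact V.2.inter W.2⟩, ?_, ?_⟩
      · exact ⟨Submodule.comap_mono inf_le_left, hsub _ _ inf_le_left⟩
      · exact ⟨Submodule.comap_mono inf_le_right, hsub _ _ inf_le_right⟩)
  refine ⟨c, hc, sub_eq_zero.1 ((Submodule.mem_bot R).1 (hbot ▸ ?_))⟩
  refine (Submodule.mem_iInf _).2 fun V => ?_
  have h1 : f (c - z V) ∈ V.1 := hcz V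
  simpa using V.1.add_mem h1 (hzy V)

lemma isOpen_of_isClosed (hX : LinComp R X) {C : Submodule R X} (hC : IsClosed (C : Set X))
    [IsArtinian R (X ⧸ C)] : IsOpen (C : Set X) := by
  have := hX.addGroup
  have := hX.t2
  have : Nonempty {V : Submodule R X // IsOpen (V : Set X)} := ⟨⟨⊤, isOpen_univ⟩⟩
  obtain ⟨V, hV⟩ := hX.exists_le_of_iInf_le
    (K := fun V : {V : Submodule R X // IsOpen (V : Set X)} => V.1)
    (fun V => isClosed_of_isOpen_submodule V.2)
    (fun V W => ⟨⟨V.1 ⊓ W.1, by rw [Submodule.coe_inf]; exact V.2.inter W.2⟩,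
      inf_le_left, inf_le_right⟩) hC (by
      intro x hx
      refine mem_of_isClosed_of_basis hX.basis hC fun V hV => ⟨0, C.zero_mem, ?_⟩
      simpa using (Submodule.mem_iInf _).1 hx ⟨V, hV⟩)
  exact isOpen_submodule_mono V.2 hV

lemma isOpen_map (hX : LinComp R X) (hY : LinComp R Y) {f : X →ₗ[R] Y} (hf : Continuous f)
    (hs : Function.Surjective f) {V : Submodule R X} (hV : IsOpen (V : Set X)) :
    IsOpen (V.map f : Set Y) := by
  have := hX.addGroup
  have := hX.artinian V hV
  have : IsArtinian R (Y ⧸ V.map f) :=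
    isArtinian_of_surjective _ (Submodule.mapQ V (V.map f) f (Submodule.le_comap_map f V)) (by
      intro z
      obtain ⟨z, rfl⟩ := (V.map f).mkQ_surjective z
      obtain ⟨z, rfl⟩ := hs z
      exact ⟨Submodule.Quotient.mk z, rfl⟩)
  exact hY.isOpen_of_isClosed (hX.isClosed_map hY hf (isClosed_of_isOpen_submodule hV))

lemma isClosed_radical (hX : LinComp R X) : IsClosed (radical R X : Set X) := by
  have := hX.addGroup
  rw [radical, Submodule.coe_sInf]
  exact isClosed_biInter fun W hW => isClosed_of_isOpen_submodule hW.2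

/-- An open submodule containing the radical is an intersection of maximal submodules. -/
lemma exists_isCoatom_of_radical_le (hX : LinComp R X) {D : Submodule R X}
    (hD : IsOpen (D : Set X)) (hle : radical R X ≤ D) {x : X} (hx : x ∉ D) :
    ∃ W : Submodule R X, IsCoatom W ∧ D ≤ W ∧ x ∉ W := by
  have := hX.addGroup
  let K : Finset {W : Submodule R X // IsCoatom W ∧ IsOpen (W : Set X)} → Submodule R X :=
    fun s => ⨅ W ∈ s, W.1
  have hKo : ∀ s, IsOpen (K s : Set X) := fun s => by
    simp only [K, Submodule.coe_iInf]
    exact isOpen_biInter_finset fun W _ => W.2.2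
  have := hX.artinian D hD
  obtain ⟨s, hs⟩ := hX.exists_le_of_iInf_le (K := K) (V := D)
    (fun s => isClosed_of_isOpen_submodule (hKo s))
    (directed_of_isDirected_le fun s t hst => biInf_mono hst)
    (isClosed_of_isOpen_submodule hD) (by
      refine le_trans (le_sInf fun W hW => ?_) hle
      exact (iInf_le _ {⟨W, hW⟩}).trans (iInf₂_le (⟨W, hW⟩ : {W : Submodule R X // _}) (by simp)))
  have := hX.artinian (K s) (hKo s)
  have hjac : Module.jacobson R (X ⧸ K s) = ⊥ := by
    refine (Submodule.eq_bot_iff _).2 fun y hy => ?_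
    obtain ⟨y, rfl⟩ := (K s).mkQ_surjective y
    rw [← LinearMap.mem_ker, Submodule.ker_mkQ]
    simp only [K, Submodule.mem_iInf]
    intro W hW
    have hKW : LinearMap.ker (K s).mkQ ≤ W.1 := by
      rw [Submodule.ker_mkQ]; exact iInf₂_le W hW
    have hmem := Submodule.mem_sInf.1 hy _
      (Submodule.isCoatom_map_of_ker_le (K s).mkQ_surjective hKW W.2.1)
    rwa [← Submodule.mem_comap, Submodule.comap_map_eq_self hKW] at hmem
  have := IsArtinian.isSemisimpleModule_iff_jacobson R (X ⧸ K s) |>.2 hjac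
  have : IsSemisimpleModule R (X ⧸ D) :=
    IsSemisimpleModule.of_surjective (Submodule.factor hs) (Submodule.factor_surjective hs)
  have hne : D.mkQ x ∉ Module.jacobson R (X ⧸ D) := by
    rw [IsSemisimpleModule.jacobson_eq_bot, Submodule.mem_bot]
    simpa using hx
  simp only [Module.jacobson, Submodule.mem_sInf, not_forall] at hne
  obtain ⟨m, hm, hxm⟩ := hne
  refine ⟨m.comap D.mkQ, (Submodule.isCoatom_comap_iff D.mkQ_surjective).2 hm, ?_, hxm⟩
  intro d hd
  have : D.mkQ d = 0 := by simpa using hd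
  simp [Submodule.mem_comap, this]

lemma map_radical (hX : LinComp R X) (hY : LinComp R Y) {f : X →ₗ[R] Y} (hf : Continuous f)
    (hs : Function.Surjective f) : (radical R X).map f = radical R Y := by
  have := hX.addGroup
  have := hY.addGroup
  apply le_antisymm
  · refine Submodule.map_le_iff_le_comap.2 fun x hx => Submodule.mem_sInf.2 fun W hW => ?_
    exact Submodule.mem_sInf.1 hx (W.comap f)
      ⟨(Submodule.isCoatom_comap_iff hs).2 hW.1, hW.2.preimage hf⟩
  · intro y hy
    obtain ⟨x, rfl⟩ := hs y
    refine mem_of_isClosed_of_basis hY.basis (hX.isClosed_map hY hf hX.isClosed_radical)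
      fun V hV => ?_
    by_contra hcon
    have hoD : IsOpen (((radical R X).map f ⊔ V : Submodule R Y) : Set Y) :=
      isOpen_submodule_mono hV le_sup_right
    have hxD : x ∉ ((radical R X).map f ⊔ V).comap f := by
      intro hx
      obtain ⟨c, hc, v, hv, hcv⟩ := Submodule.mem_sup.1 (Submodule.mem_comap.1 hx)
      refine hcon ⟨c, hc, ?_⟩
      rw [← hcv]
      simpa using hv
    obtain ⟨W, hW, hDW, hxW⟩ := hX.exists_isCoatom_of_radical_le
      (D := ((radical R X).map f ⊔ V).comap f) (hoD.preimage hf)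
      (Submodule.map_le_iff_le_comap.1 le_sup_left) hxD
    have hker : LinearMap.ker f ≤ W := (Submodule.comap_mono bot_le).trans hDW
    have hWo : IsOpen (W.map f : Set Y) := isOpen_submodule_mono hoD (by
      rw [← Submodule.map_comap_eq_of_surjective hs ((radical R X).map f ⊔ V)]
      exact Submodule.map_mono hDW)
    have hmem := Submodule.mem_sInf.1 hy _
      ⟨Submodule.isCoatom_map_of_ker_le hs hker hW, hWo⟩
    rw [← Submodule.mem_comap, Submodule.comap_map_eq_self hker] at hmem
    exact hxW hmem

lemma isClosed_radPow (hX : LinComp R X) : ∀ i, IsClosed (radPow R X i : Set X)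
  | 0 => isClosed_univ
  | i + 1 => by
    rw [radPow, Submodule.map_coe]
    exact (hX.isClosed_radPow i).isClosedEmbedding_subtypeVal.isClosedMap _
      (hX.submodule (hX.isClosed_radPow i)).isClosed_radical

lemma map_radPow (hX : LinComp R X) (hY : LinComp R Y) {f : X →ₗ[R] Y} (hf : Continuous f)
    (hs : Function.Surjective f) (i : ℕ) : (radPow R X i).map f = radPow R Y i := by
  induction i with
  | zero => simpa [radPow] using LinearMap.range_eq_top.2 hs
  | succ i ih =>
    have hmem : ∀ x ∈ radPow R X i, f x ∈ radPow R Y i := fun x hx =>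
      ih ▸ Submodule.mem_map_of_mem hx
    have hg := (hX.submodule (hX.isClosed_radPow i)).map_radical
      (hY.submodule (hY.isClosed_radPow i)) (f := f.restrict hmem)
      ((hf.comp continuous_subtype_val).subtype_mk _) (by
        rintro ⟨y, hy⟩
        rw [← ih] at hy
        obtain ⟨x, hx, rfl⟩ := hy
        exact ⟨⟨x, hx⟩, rfl⟩)
    rw [radPow, radPow, ← hg, ← Submodule.map_comp, ← Submodule.map_comp]
    rfl

end LinComp

lemma IsPseudocompactMod.linComp {k A X : Type} [Field k] [Ring A] [Algebra k A]
    [TopologicalSpace A] [AddCommGroup X] [Module k X] [Module A X] [IsScalarTower k A X]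
    [TopologicalSpace X] (hX : IsPseudocompactMod k A X) : LinComp A X := by
  have := hX.t2
  have := hX.addGroup
  refine LinComp.of_complete hX.basis (fun V hV => hV.1) (fun V hV => ?_) fun c hc => ?_
  · have : FiniteDimensional k (X ⧸ V) := hV.2
    exact isArtinian_of_tower k inferInstance
  · obtain ⟨x, hx⟩ := hX.complete (fun V => Submodule.Quotient.mk (c V)) fun V W h => by
      rw [mapQ', dif_pos (show V.1 ≤ W.1.comap LinearMap.id from h)]
      exact (Submodule.Quotient.eq W.1).2 (hc V W h)
    refine ⟨x, fun V => ?_⟩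
    exact (Submodule.Quotient.eq V.1).1 (hx V).symm

lemma subQuotMap_mk {R X Y : Type} [Ring R] [AddCommGroup X] [AddCommGroup Y] [Module R X]
    [Module R Y] {W W' : Submodule R X} {V V' : Submodule R Y} {f : X →ₗ[R] Y}
    (h : ∀ x ∈ W, f x ∈ V) (h' : ∀ x ∈ W', f x ∈ V') (w : W) :
    subQuotMap W W' V V' f (Submodule.Quotient.mk w) = Submodule.Quotient.mk ⟨f w, h w w.2⟩ := by
  have hr : restrict' W V f = f.restrict h := dif_pos h
  have hc : W'.comap W.subtype ≤ (V'.comap V.subtype).comap (f.restrict h) :=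
    fun x hx => h' x hx
  rw [subQuotMap, mapQ', hr, dif_pos hc]
  rfl

lemma continuous_subQuotMap {R X Y : Type} [Ring R] [AddCommGroup X] [AddCommGroup Y]
    [Module R X] [Module R Y] [TopologicalSpace X] [TopologicalSpace Y]
    {W W' : Submodule R X} {V V' : Submodule R Y} {f : X →ₗ[R] Y} (hf : Continuous f)
    (h : ∀ x ∈ W, f x ∈ V) (h' : ∀ x ∈ W', f x ∈ V') :
    Continuous (subQuotMap W W' V V' f) := by
  rw [(Submodule.isQuotientMap_mkQ _).continuous_iff]
  have heq : subQuotMap W W' V V' f ∘ Submodule.mkQ (W'.comap W.subtype) =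
      Submodule.mkQ (V'.comap V.subtype) ∘ f.restrict h := funext fun w => subQuotMap_mk h h' w
  rw [heq]
  exact (Submodule.continuous_mkQ _).comp ((hf.comp continuous_subtype_val).subtype_mk _)

lemma nonempty_openNormalSubgroup (G : Type) [Group G] [TopologicalSpace G] :
    Nonempty (OpenNormalSubgroup G) :=
  ⟨{ toOpenSubgroup := ⊤, isNormal' := inferInstanceAs (⊤ : Subgroup G).Normal }⟩

section Coinvariants

variable {k : Type} [Field k] {G : Type} [Group G] [TopologicalSpace G]

lemma continuous_ofG [IsTopologicalGroup G] : Continuous (ofG k G) := by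
  refine Continuous.subtype_mk (continuous_pi fun N => ?_) _
  have : DiscreteTopology (G ⧸ N.toSubgroup) := QuotientGroup.discreteTopology N.isOpen'
  exact (continuous_of_discreteTopology
    (f := fun q : G ⧸ N.toSubgroup => MonoidAlgebra.single q (1 : k))).comp
    QuotientGroup.continuous_mk

variable {U : Type} [AddCommGroup U] [Module (CGA k G) U] [TopologicalSpace U]

lemma isClosed_coinvKer (N : OpenNormalSubgroup G) : IsClosed (coinvKer k G N U : Set U) := by
  rw [coinvKer, Submodule.coe_sInf]
  exact isClosed_biInter fun W hW => hW.1

lemma phi_surjective (N : OpenNormalSubgroup G) : Function.Surjective (phi k G N U) :=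
  Submodule.mkQ_surjective _

lemma continuous_phi (N : OpenNormalSubgroup G) : Continuous (phi k G N U) :=
  Submodule.continuous_mkQ _

lemma phiT_surjective {N M : OpenNormalSubgroup G} (h : N ≤ M) :
    Function.Surjective (phiT k G N M h U) := fun y => by
  obtain ⟨u, rfl⟩ := phi_surjective M y
  exact ⟨phi k G N U u, rfl⟩

lemma continuous_phiT {N M : OpenNormalSubgroup G} (h : N ≤ M) :
    Continuous (phiT k G N M h U) :=
  (continuous_phi M).quotient_lift _

lemma map_radPow_phi (hU : LinComp (CGA k G) U) (N : OpenNormalSubgroup G) (i : ℕ) :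
    (radPow (CGA k G) U i).map (phi k G N U) = radPow (CGA k G) (coinv k G N U) i :=
  hU.map_radPow (hU.quotient (isClosed_coinvKer N)) (continuous_phi N) (phi_surjective N) i

lemma map_radPow_phiT (hU : LinComp (CGA k G) U) {N M : OpenNormalSubgroup G} (h : N ≤ M)
    (i : ℕ) : (radPow (CGA k G) (coinv k G N U) i).map (phiT k G N M h U) =
      radPow (CGA k G) (coinv k G M U) i :=
  (hU.quotient (isClosed_coinvKer N)).map_radPow (hU.quotient (isClosed_coinvKer M))
    (continuous_phiT h) (phiT_surjective h) i

/-- An open subspace of finite codimension absorbs the augmentation of some open normal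
subgroup. -/
lemma exists_coinvKer_le [IsTopologicalGroup G] [CompactSpace G] [TotallyDisconnectedSpace G]
    [T2Space G] [Module k U] [IsScalarTower k (CGA k G) U] [IsTopologicalAddGroup U]
    [ContinuousSMul (CGA k G) U] {V : Submodule (CGA k G) U} (hV : IsOpen (V : Set U))
    (hfin : FiniteDimensional k (U ⧸ V.restrictScalars k)) :
    ∃ N : OpenNormalSubgroup G, coinvKer k G N U ≤ V := by
  have hstab : ∀ u : U, ∃ N : OpenNormalSubgroup G, ∀ n ∈ N.toSubgroup,
      ofG k G n • u - u ∈ V := fun u => by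
    have hcont : Continuous fun g : G => ofG k G g • u - u :=
      (continuous_ofG.smul continuous_const).sub continuous_const
    obtain ⟨N, hN⟩ := ProfiniteGrp.exist_openNormalSubgroup_sub_open_nhds_of_one
      (hV.preimage hcont) (by simp)
    exact ⟨N, fun n hn => hN hn⟩
  choose S hS using hstab
  obtain ⟨s, hs⟩ := hfin.fg_top
  have := nonempty_openNormalSubgroup G
  have hdir : Directed (· ≥ ·) (id : OpenNormalSubgroup G → OpenNormalSubgroup G) :=
    fun N M => ⟨N ⊓ M, inf_le_left, inf_le_right⟩
  obtain ⟨N, hN⟩ := hdir.finset_le (s.image fun q => S q.out)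
  have := IsScalarTower.to_smulCommClass (R := k) (A := CGA k G) (M := U)
  let F : Submodule k U :=
    { carrier := {u | ∀ n ∈ N.toSubgroup, ofG k G n • u - u ∈ V}
      add_mem' := fun {a b} ha hb n hn => by
        rw [smul_add, add_sub_add_comm]
        exact V.add_mem (ha n hn) (hb n hn)
      zero_mem' := fun n _ => by simp
      smul_mem' := fun c u hu n hn => by
        rw [smul_comm, ← smul_sub]
        exact (V.restrictScalars k).smul_mem c (hu n hn) }
  have hVF : ∀ v ∈ V, v ∈ F := fun v hv n _ => V.sub_mem (V.smul_mem _ hv) hv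
  have hF : F.map (V.restrictScalars k).mkQ = ⊤ := by
    rw [eq_top_iff, ← hs, Submodule.span_le]
    intro q hq
    have hle : N ≤ S q.out := hN _ (Finset.mem_image_of_mem (fun q => S q.out) hq)
    exact ⟨q.out, fun n hn => hS _ n (hle hn), q.out_eq⟩
  refine ⟨N, sInf_le ⟨isClosed_of_isOpen_submodule hV, fun n hn u => ?_⟩⟩
  obtain ⟨f, hf, hfu⟩ : (V.restrictScalars k).mkQ u ∈ F.map (V.restrictScalars k).mkQ :=
    hF ▸ trivial
  have hfu' : f - u ∈ V := (Submodule.Quotient.eq (V.restrictScalars k)).1 hfu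
  have : u ∈ F := by simpa using F.sub_mem hf (hVF _ hfu')
  exact this n hn

end Coinvariants

section Coinvariants

variable {k : Type} [Field k] {G : Type} [Group G] [TopologicalSpace G]
  [IsTopologicalGroup G] [CompactSpace G] [TotallyDisconnectedSpace G] [T2Space G]
  {U : Type} [AddCommGroup U] [Module k U] [Module (CGA k G) U]
  [IsScalarTower k (CGA k G) U] [TopologicalSpace U]

lemma iInf_coinvKer (hU : IsPseudocompactMod k (CGA k G) U) :
    ⨅ N : OpenNormalSubgroup G, coinvKer k G N U = ⊥ := by
  have := hU.addGroup
  have := hU.contSMul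
  rw [← le_bot_iff, ← hU.inf_bot]
  refine le_iInf₂ fun V hV => ?_
  obtain ⟨N, hN⟩ := exists_coinvKer_le hV.1 hV.2
  exact (iInf_le _ N).trans hN

lemma radPow_eq_iInf (hU : IsPseudocompactMod k (CGA k G) U) (i : ℕ) :
    radPow (CGA k G) U i = ⨅ N : OpenNormalSubgroup G,
      (radPow (CGA k G) (coinv k G N U) i).comap (phi k G N U) := by
  have hL := hU.linComp
  apply le_antisymm
  · exact le_iInf fun N => Submodule.map_le_iff_le_comap.1 (map_radPow_phi hL N i).le
  · intro x hx
    have key : ∀ N : OpenNormalSubgroup G,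
        ∃ z ∈ radPow (CGA k G) U i, z - x ∈ coinvKer k G N U := fun N => by
      have hxN := (Submodule.mem_iInf _).1 hx N
      rw [Submodule.mem_comap, ← map_radPow_phi hL N i] at hxN
      obtain ⟨z, hz, hzx⟩ := hxN
      exact ⟨z, hz, (Submodule.Quotient.eq _).1 hzx⟩
    choose z hz hzx using key
    have hsub : ∀ N M : OpenNormalSubgroup G, N ≤ M → z N - z M ∈ coinvKer k G M U :=
      fun N M h => by simpa using sub_mem (coinvKer_mono h U (hzx N)) (hzx M)
    have := nonempty_openNormalSubgroup G
    obtain ⟨y, hy, hyz⟩ := hL.exists_mem_of_directed (hL.isClosed_radPow i)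
      (fun N => coinvKer k G N U) isClosed_coinvKer z hz (fun N M =>
        ⟨N ⊓ M, ⟨coinvKer_mono inf_le_left U, hsub _ _ inf_le_left⟩,
          coinvKer_mono inf_le_right U, hsub _ _ inf_le_right⟩)
    have hyx : y - x ∈ (⊥ : Submodule (CGA k G) U) := by
      rw [← iInf_coinvKer hU, Submodule.mem_iInf]
      intro N
      simpa using add_mem (hyz N) (hzx N)
    rwa [← sub_eq_zero.1 ((Submodule.mem_bot _).1 hyx)]

end Coinvariants

lemma LinComp.subQuot {R X : Type} [Ring R] [AddCommGroup X] [Module R X] [TopologicalSpace X]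
    (hX : LinComp R X) {W W' : Submodule R X} (hW : IsClosed (W : Set X))
    (hW' : IsClosed (W' : Set X)) : LinComp R (subQuot W W') :=
  (hX.submodule hW).quotient (hW'.preimage continuous_subtype_val)

section Limit

variable {ι : Type} [SemilatticeInf ι] {R Q : Type} [Ring R] [AddCommGroup Q]
  [Module R Q] [TopologicalSpace Q] {T : ι → Type} [∀ i, AddCommGroup (T i)]
  [∀ i, Module R (T i)] {t : ∀ i j, i ≤ j → (T i →ₗ[R] T j)} {q : ∀ i, Q →ₗ[R] T i}

/-- The linear map to an inverse limit given by a compatible family of linear maps. -/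
def toCompatLim (hqt : ∀ i j h x, t i j h (q i x) = q j x) : Q →ₗ[R] compatLim T t :=
  (LinearMap.pi q).codRestrict _ fun x i j h => hqt i j h x

lemma ker_mono_of_compat (hqt : ∀ i j h x, t i j h (q i x) = q j x) {i j : ι} (h : i ≤ j) :
    LinearMap.ker (q i) ≤ LinearMap.ker (q j) := fun x hx => by
  rw [LinearMap.mem_ker] at hx ⊢
  rw [← hqt i j h, hx, map_zero]

lemma toCompatLim_injective (hqt : ∀ i j h x, t i j h (q i x) = q j x)
    (hbot : ⨅ i, LinearMap.ker (q i) = ⊥) : Function.Injective (toCompatLim hqt) := by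
  refine (injective_iff_map_eq_zero _).2 fun x hx => ?_
  rw [← Submodule.mem_bot (R := R), ← hbot, Submodule.mem_iInf]
  exact fun i => congrFun (congrArg Subtype.val hx) i

variable [Nonempty ι] [∀ i, TopologicalSpace (T i)]

lemma LinComp.toCompatLim_surjective (hQ : LinComp R Q) (hT : ∀ i, LinComp R (T i))
    (hqt : ∀ i j h x, t i j h (q i x) = q j x) (hq : ∀ i, Continuous (q i))
    (hs : ∀ i, Function.Surjective (q i)) : Function.Surjective (toCompatLim hqt) := fun c => by
  have := fun i => (hT i).t2
  choose z hz using fun i => hs i (c.1 i)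
  have hsub : ∀ i j : ι, i ≤ j → z i - z j ∈ LinearMap.ker (q j) := fun i j h => by
    rw [LinearMap.mem_ker, map_sub, hz j, ← hqt i j h, hz i, c.2 i j h, sub_self]
  obtain ⟨x, -, hx⟩ := hQ.exists_mem_of_directed (C := ⊤) isClosed_univ
    (fun i => LinearMap.ker (q i)) (fun i => isClosed_singleton.preimage (hq i)) z
    (fun _ => trivial) (fun i j => ⟨i ⊓ j,
      ⟨ker_mono_of_compat hqt inf_le_left, hsub _ _ inf_le_left⟩,
      ker_mono_of_compat hqt inf_le_right, hsub _ _ inf_le_right⟩)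
  refine ⟨x, Subtype.ext (funext fun i => ?_)⟩
  rw [← hz i, ← sub_eq_zero]
  exact (map_sub (q i) x (z i)).symm.trans (hx i)

/-- A linearly compact module is the inverse limit of a separating system of quotients, as a
topological module. -/
def LinComp.equivCompatLim (hQ : LinComp R Q) (hT : ∀ i, LinComp R (T i))
    (hqt : ∀ i j h x, t i j h (q i x) = q j x) (hq : ∀ i, Continuous (q i))
    (hs : ∀ i, Function.Surjective (q i)) (hbot : ⨅ i, LinearMap.ker (q i) = ⊥) :
    Q ≃L[R] compatLim T t where
  toLinearEquiv := LinearEquiv.ofBijective (toCompatLim hqt)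
    ⟨toCompatLim_injective hqt hbot, hQ.toCompatLim_surjective hT hqt hq hs⟩
  continuous_toFun := Continuous.subtype_mk (continuous_pi hq) _
  continuous_invFun := by
    have := hQ.addGroup
    have := fun i => (hT i).addGroup
    have := fun i => (hT i).t2
    let e := LinearEquiv.ofBijective (toCompatLim hqt)
      ⟨toCompatLim_injective hqt hbot, hQ.toCompatLim_surjective hT hqt hq hs⟩
    refine continuous_of_continuousAt_zero e.symm ?_
    rw [ContinuousAt, map_zero, hQ.basis.tendsto_right_iff]
    intro V hV
    have := hQ.artinian V hV
    obtain ⟨i, hi⟩ := hQ.exists_le_of_iInf_le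
      (fun i => isClosed_singleton.preimage (hq i) : ∀ i, IsClosed (LinearMap.ker (q i) : Set Q))
      (fun i j => ⟨i ⊓ j, ker_mono_of_compat hqt inf_le_left,
        ker_mono_of_compat hqt inf_le_right⟩)
      (isClosed_of_isOpen_submodule hV) (hbot.trans_le bot_le)
    have ho := hQ.isOpen_map (hT i) (hq i) (hs i) hV
    have hcont : Continuous fun c : compatLim T t => c.1 i :=
      (continuous_apply i).comp continuous_subtype_val
    filter_upwards [(ho.preimage hcont).mem_nhds (show (0 : compatLim T t) ∈ _ from
      Submodule.zero_mem _)] with c hc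
    obtain ⟨v, hv, hvc⟩ := hc
    have hsymm : q i (e.symm c) = c.1 i :=
      congrFun (congrArg Subtype.val (e.apply_symm_apply c)) i
    have hker : e.symm c - v ∈ LinearMap.ker (q i) := by
      rw [LinearMap.mem_ker, map_sub, hsymm, hvc, sub_self]
    simpa using V.add_mem (hi hker) hv

end Limit

section Coinvariants

variable {k : Type} [Field k] {G : Type} [Group G] [TopologicalSpace G]
  {U : Type} [AddCommGroup U] [Module (CGA k G) U] [TopologicalSpace U]

variable (k G U) in
/-- The layer `Rad^i(U_N)/Rad^{i+1}(U_N)` of the radical series of the coinvariants. -/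
abbrev coinvLayer (i : ℕ) (N : OpenNormalSubgroup G) : Type :=
  subQuot (radPow (CGA k G) (coinv k G N U) i) (radPow (CGA k G) (coinv k G N U) (i + 1))

variable (k G U) in
/-- The projection of a layer of the radical series of `U` to that of `U_N`. -/
abbrev layerProj (i : ℕ) (N : OpenNormalSubgroup G) :
    subQuot (radPow (CGA k G) U i) (radPow (CGA k G) U (i + 1)) →ₗ[CGA k G]
      coinvLayer k G U i N :=
  subQuotMap _ _ _ _ (phi k G N U)

lemma phi_mem_radPow (hU : LinComp (CGA k G) U) (N : OpenNormalSubgroup G) (i : ℕ) :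
    ∀ x ∈ radPow (CGA k G) U i, phi k G N U x ∈ radPow (CGA k G) (coinv k G N U) i :=
  fun _ hx => map_radPow_phi hU N i ▸ Submodule.mem_map_of_mem hx

lemma phiT_mem_radPow (hU : LinComp (CGA k G) U) {N M : OpenNormalSubgroup G} (h : N ≤ M)
    (i : ℕ) : ∀ x ∈ radPow (CGA k G) (coinv k G N U) i,
      phiT k G N M h U x ∈ radPow (CGA k G) (coinv k G M U) i :=
  fun _ hx => map_radPow_phiT hU h i ▸ Submodule.mem_map_of_mem hx

lemma layerProj_mk (hU : LinComp (CGA k G) U) (i : ℕ) (N : OpenNormalSubgroup G)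
    (w : radPow (CGA k G) U i) :
    layerProj k G U i N (Submodule.Quotient.mk w) =
      Submodule.Quotient.mk ⟨phi k G N U w, phi_mem_radPow hU N i w w.2⟩ :=
  subQuotMap_mk (phi_mem_radPow hU N i) (phi_mem_radPow hU N (i + 1)) w

lemma subQuotMap_phiT_layerProj (hU : LinComp (CGA k G) U) (i : ℕ)
    {N M : OpenNormalSubgroup G} (h : N ≤ M)
    (x : subQuot (radPow (CGA k G) U i) (radPow (CGA k G) U (i + 1))) :
    subQuotMap _ _ _ _ (phiT k G N M h U) (layerProj k G U i N x) = layerProj k G U i M x := by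
  obtain ⟨w, rfl⟩ := Submodule.Quotient.mk_surjective _ x
  rw [layerProj_mk hU, layerProj_mk hU,
    subQuotMap_mk (phiT_mem_radPow hU h i) (phiT_mem_radPow hU h (i + 1))]
  rfl

lemma layerProj_surjective (hU : LinComp (CGA k G) U) (i : ℕ) (N : OpenNormalSubgroup G) :
    Function.Surjective (layerProj k G U i N) := fun y => by
  obtain ⟨⟨v, hv⟩, rfl⟩ := Submodule.Quotient.mk_surjective _ y
  obtain ⟨u, hu, rfl⟩ := (map_radPow_phi hU N i).symm ▸ hv
  exact ⟨Submodule.Quotient.mk ⟨u, hu⟩, layerProj_mk hU i N _⟩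

variable [IsTopologicalGroup G] [CompactSpace G] [TotallyDisconnectedSpace G] [T2Space G]
  [Module k U] [IsScalarTower k (CGA k G) U]

lemma iInf_ker_layerProj (hU : IsPseudocompactMod k (CGA k G) U) (i : ℕ) :
    ⨅ N, LinearMap.ker (layerProj k G U i N) = ⊥ := by
  refine (Submodule.eq_bot_iff _).2 fun x hx => ?_
  obtain ⟨w, rfl⟩ := Submodule.Quotient.mk_surjective _ x
  rw [Submodule.Quotient.mk_eq_zero, Submodule.mem_comap, radPow_eq_iInf hU,
    Submodule.mem_iInf]
  intro N
  have hN := (Submodule.mem_iInf _).1 hx N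
  rwa [LinearMap.mem_ker, layerProj_mk hU.linComp, Submodule.Quotient.mk_eq_zero] at hN

/-- The layers of the radical series of `U` are the inverse limits of those of its
coinvariants. -/
def layerEquiv (hU : IsPseudocompactMod k (CGA k G) U) (i : ℕ) :
    subQuot (radPow (CGA k G) U i) (radPow (CGA k G) U (i + 1)) ≃L[CGA k G]
      compatLim (fun N => coinvLayer k G U i N)
        (fun N M h => subQuotMap _ _ _ _ (phiT k G N M h U)) :=
  have hL := hU.linComp
  have hN := fun N : OpenNormalSubgroup G => hL.quotient (isClosed_coinvKer N)
  have := nonempty_openNormalSubgroup G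
  (hL.subQuot (hL.isClosed_radPow i) (hL.isClosed_radPow (i + 1))).equivCompatLim
    (q := layerProj k G U i)
    (fun N => (hN N).subQuot ((hN N).isClosed_radPow i) ((hN N).isClosed_radPow (i + 1)))
    (fun N M h x => subQuotMap_phiT_layerProj hL i h x)
    (fun N => continuous_subQuotMap (continuous_phi N) (phi_mem_radPow hL N i)
      (phi_mem_radPow hL N (i + 1)))
    (fun N => layerProj_surjective hL i N) (iInf_ker_layerProj hU i)

end Coinvariants

end LinearCompactness

/-- Lemma 2.7: For a pseudocompact `k⟦G⟧`-module `U`: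
(1) for each `i ≥ 1`, `Rad^i(U) = lim_N Rad^i(U_N)` and the connecting maps of the
system of radicals are surjective; (2) for each `i ≥ 0`,
`Rad^i(U)/Rad^{i+1}(U) ≅ lim_N Rad^i(U_N)/Rad^{i+1}(U_N)`. -/
theorem radical_eq_limit_of_radicals
    (p : ℕ) [Fact p.Prime] (k : Type) [Field k] [CharP k p]
    (G : Type) [Group G] [TopologicalSpace G] [IsTopologicalGroup G]
    [CompactSpace G] [TotallyDisconnectedSpace G] [T2Space G]
    (U : Type) [AddCommGroup U] [Module k U] [Module (CGA k G) U]
    [IsScalarTower k (CGA k G) U] [TopologicalSpace U]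
    (hU : IsPseudocompactMod k (CGA k G) U) :
    (∀ i : ℕ, 1 ≤ i →
      (∀ (N M : OpenNormalSubgroup G) (h : N ≤ M),
        (radPow (CGA k G) (coinv k G N U) i).map (phiT k G N M h U) =
          radPow (CGA k G) (coinv k G M U) i) ∧
      radPow (CGA k G) U i =
        ⨅ N : OpenNormalSubgroup G,
          (radPow (CGA k G) (coinv k G N U) i).comap (phi k G N U)) ∧
    (∀ i : ℕ,
      Nonempty ((subQuot (radPow (CGA k G) U i) (radPow (CGA k G) U (i + 1)))
        ≃L[CGA k G]
        compatLim (fun N : OpenNormalSubgroup G =>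
            subQuot (radPow (CGA k G) (coinv k G N U) i)
              (radPow (CGA k G) (coinv k G N U) (i + 1)))
          (fun N M h => subQuotMap _ _ _ _ (phiT k G N M h U)))) := by
  have hL := hU.linComp
  exact ⟨fun i _ => ⟨fun N M h => map_radPow_phiT hL h i, radPow_eq_iInf hU i⟩,
    fun i => ⟨layerEquiv hU i⟩⟩

end ProfiniteBlocks
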